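/- Suppose 1 ≤ s ≤ r is an index with p ∤ γ_s, and let c be an integer with c·γ_s ≡ 1 (mod p). Define ξ̃_0 = ξ_0 − c·γ_0·ξ_s and ξ̃_i = ξ_i − c·γ_i·ξ_s for each i ∈ {1,…,r} with i ≠ s. Then f(ξ̃_0) ≡ b (mod p^{ℓ+1}) and f(ξ̃_i) ≡ 0 (mod p^{ℓ+1}) for each i ≠ s; consequently, for every choice of integers t_i (i ≠ s), the vector ξ̃_0 + Σ_{i≠s} t_i·ξ̃_i satisfies f(ξ̃_0 + Σ_{i≠s} t_i·ξ̃_i) ≡ b (mod p^{ℓ+1}). -/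

import Mathlib

/-- If `c` inverts `w` modulo `p`, then subtracting `c * q` times `P * w` from `P * q` gains a
factor `p`. -/
theorem mul_dvd_mul_sub_of_modEq_one {p P q w c : ℤ} (hc : c * w ≡ 1 [ZMOD p]) :
    P * p ∣ P * q - c * q * (P * w) := by
  have h : P * q - c * q * (P * w) = P * (1 - c * w) * q := by ring
  rw [h]
  exact (mul_dvd_mul_left P hc.dvd).mul_right q

/-- Eliminating a free variable: if `p ∤ γ_s` and `c·γ_s ≡ 1 (mod p)`, then the
modified vectors `ξ̃₀ = ξ₀ - c·γ₀·ξ_s` and `ξ̃ᵢ = ξᵢ - c·γᵢ·ξ_s` (for `i ≠ s`)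
satisfy `f ξ̃₀ ≡ b` and `f ξ̃ᵢ ≡ 0 (mod p^(ℓ+1))`; hence every combination
`ξ̃₀ + Σ_{i≠s} tᵢ·ξ̃ᵢ` solves `f x ≡ b (mod p^(ℓ+1))`. -/
theorem eliminate_free_variable (p : ℕ) (hp : p.Prime) (ℓ m : ℕ) (hℓ : 1 ≤ ℓ)
    (hm : 1 ≤ m) (a : Fin m → ℤ) (b : ℤ)
    (f : (Fin m → ℤ) → ℤ) (hf : ∀ x, f x = ∑ i, a i * x i)
    (r : ℕ) (ξ₀ : Fin m → ℤ) (ξ : Fin r → Fin m → ℤ)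
    (hξ₀ : f ξ₀ ≡ b [ZMOD (p : ℤ) ^ ℓ])
    (hξ : ∀ i, f (ξ i) ≡ 0 [ZMOD (p : ℤ) ^ ℓ])
    (γ₀ : ℤ) (hγ₀ : γ₀ = (f ξ₀ - b) / (p : ℤ) ^ ℓ)
    (γ : Fin r → ℤ) (hγ : ∀ i, γ i = f (ξ i) / (p : ℤ) ^ ℓ)
    (s : Fin r) (hs : ¬ (p : ℤ) ∣ γ s) (c : ℤ) (hc : c * γ s ≡ 1 [ZMOD (p : ℤ)]) :
    (f (ξ₀ - (c * γ₀) • ξ s) ≡ b [ZMOD (p : ℤ) ^ (ℓ + 1)]) ∧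
    (∀ i : Fin r, i ≠ s → f (ξ i - (c * γ i) • ξ s) ≡ 0 [ZMOD (p : ℤ) ^ (ℓ + 1)]) ∧
    (∀ t : Fin r → ℤ,
      f ((ξ₀ - (c * γ₀) • ξ s) +
          ∑ i ∈ Finset.univ.erase s, t i • (ξ i - (c * γ i) • ξ s))
        ≡ b [ZMOD (p : ℤ) ^ (ℓ + 1)]) := by
  obtain ⟨g, rfl⟩ : ∃ g : (Fin m → ℤ) →ₗ[ℤ] ℤ, f = g :=
    ⟨Fintype.linearCombination ℤ a, funext fun x => by
      simp [hf, Fintype.linearCombination_apply, mul_comm]⟩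
  have hγ₀' : g ξ₀ - b = (p : ℤ) ^ ℓ * γ₀ := by
    rw [hγ₀, Int.mul_ediv_cancel' hξ₀.symm.dvd]
  have hγ' (i : Fin r) : g (ξ i) = (p : ℤ) ^ ℓ * γ i := by
    rw [hγ, Int.mul_ediv_cancel' (Int.modEq_zero_iff_dvd.mp (hξ i))]
  have base : g (ξ₀ - (c * γ₀) • ξ s) ≡ b [ZMOD (p : ℤ) ^ (ℓ + 1)] := by
    refine (Int.modEq_iff_dvd.mpr ?_).symm
    rw [map_sub, map_smul, smul_eq_mul, sub_right_comm, hγ₀', hγ', pow_succ]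
    exact mul_dvd_mul_sub_of_modEq_one hc
  have homog (i : Fin r) : (p : ℤ) ^ (ℓ + 1) ∣ g (ξ i - (c * γ i) • ξ s) := by
    rw [map_sub, map_smul, smul_eq_mul, hγ', hγ', pow_succ]
    exact mul_dvd_mul_sub_of_modEq_one hc
  refine ⟨base, fun i _ => Int.modEq_zero_iff_dvd.mpr (homog i), fun t => ?_⟩
  rw [map_add, map_sum]
  have hsum : (p : ℤ) ^ (ℓ + 1) ∣
      ∑ i ∈ Finset.univ.erase s, g (t i • (ξ i - (c * γ i) • ξ s)) :=
    Finset.dvd_sum fun i _ => by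
      rw [map_smul, smul_eq_mul]
      exact (homog i).mul_left (t i)
  simpa using base.add (Int.modEq_zero_iff_dvd.mpr hsum)
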